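/- The Heawood graph has a proper distinguishing coloring with 4 colors; that is, χ_D(Heawood) ≤ 4. -/

import Mathlib

/-- A coloring `φ` of the vertices of `G` is a proper distinguishing coloring if adjacent
vertices get different colors and the only automorphism of `G` preserving all colors is
the identity. -/
def IsProperDistinguishingColoring {V α : Type*} (G : SimpleGraph V) (φ : V → α) : Prop :=
  (∀ u v, G.Adj u v → φ u ≠ φ v) ∧
    ∀ f : G ≃g G, (∀ v, φ (f v) = φ v) → ∀ v, f v = v

/-- The Heawood graph: vertices `0, …, 13` arranged in a cycle `0-1-⋯-13-0`, together with
the chords joining each even vertex `i` to `i + 5 (mod 14)`. -/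
def heawoodGraph : SimpleGraph (Fin 14) :=
  SimpleGraph.fromRel (fun a b =>
    (a.val + 1) % 14 = b.val ∨ (a.val % 2 = 0 ∧ (a.val + 5) % 14 = b.val))

/-- One round of color refinement: each vertex also records the set of colors of its neighbors. -/
def refineColoring {V α : Type*} [Fintype V] [DecidableEq α] (G : SimpleGraph V)
    [DecidableRel G.Adj] (φ : V → α) (v : V) : α × Finset α :=
  (φ v, (G.neighborFinset v).image φ)

/-- An automorphism preserving a coloring preserves its refinement. -/
theorem refineColoring_apply_iso {V α : Type*} [Fintype V] [DecidableEq α] (G : SimpleGraph V)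
    [DecidableRel G.Adj] {φ : V → α} (f : G ≃g G) (hf : ∀ v, φ (f v) = φ v) (v : V) :
    refineColoring G φ (f v) = refineColoring G φ v := by
  refine Prod.ext (hf v) ?_
  ext c
  simp only [refineColoring, Finset.mem_image, SimpleGraph.mem_neighborFinset]
  constructor
  · rintro ⟨u, hu, rfl⟩
    obtain ⟨w, rfl⟩ := f.surjective u
    exact ⟨w, f.map_adj_iff.mp hu, (hf w).symm⟩
  · rintro ⟨u, hu, rfl⟩
    exact ⟨f u, f.map_adj_iff.mpr hu, hf u⟩

instance : DecidableRel heawoodGraph.Adj := fun a b =>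
  inferInstanceAs (Decidable (a ≠ b ∧
    (((a.val + 1) % 14 = b.val ∨ (a.val % 2 = 0 ∧ (a.val + 5) % 14 = b.val)) ∨
      ((b.val + 1) % 14 = a.val ∨ (b.val % 2 = 0 ∧ (b.val + 5) % 14 = a.val)))))

/-- The Heawood graph has a proper distinguishing 4-coloring, i.e. `χ_D ≤ 4`. -/
theorem chiD_heawood_le_four :
    ∃ φ : Fin 14 → Fin 4, IsProperDistinguishingColoring heawoodGraph φ := by
  refine ⟨![2, 0, 2, 1, 2, 3, 0, 1, 3, 0, 3, 1, 3, 0], by decide +kernel, fun f hf v => ?_⟩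
  have h_inj : Function.Injective (refineColoring heawoodGraph (refineColoring heawoodGraph
      (![2, 0, 2, 1, 2, 3, 0, 1, 3, 0, 3, 1, 3, 0] : Fin 14 → Fin 4))) := by
    decide +kernel
  exact h_inj (refineColoring_apply_iso _ f (refineColoring_apply_iso _ f hf) v)
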